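/- Let K be the attractor of an IFS of similitudes on a complete metric space, endowed with its natural fractal structure. If (LSP2) holds, i.e., int_K(A_𝐢) ≠ ∅ for every word 𝐢, and whenever A_𝐢 ⊆ A_𝐣 for words 𝐢 ∈ Σ^n, 𝐣 ∈ Σ^m the word 𝐣 is a prefix of 𝐢, then the natural fractal structure is irreducible. -/

import Mathlib

open scoped ENNReal

namespace IFSMoran

variable {X : Type*} [MetricSpace X]

/-- The map `f_i = f_{i1} o ... o f_{in}` associated to a word `i = i1...in`
(a list of indices). -/
def wMap {k : ℕ} (f : Fin k → X → X) : List (Fin k) → X → X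
  | [] => id
  | i :: w => f i ∘ wMap f w

/-- The piece `A_i = f_i(K)` of the natural fractal structure. -/
def piece {k : ℕ} (f : Fin k → X → X) (K : Set X) (w : List (Fin k)) : Set X :=
  wMap f w '' K

/-- The natural fractal structure (levels indexed by words) is irreducible:
no level admits a proper subcovering. -/
def Irred {k : ℕ} (f : Fin k → X → X) (K : Set X) : Prop :=
  ∀ w : List (Fin k),
    ¬ piece f K w ⊆ ⋃ v ∈ {v : List (Fin k) | v.length = w.length ∧ v ≠ w}, piece f K v

/-- `H³ₙˢ(K) = inf_{l ≥ n} ∑_{i ∈ Σˡ} diam (A_i) ^ s`. -/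
noncomputable def H3n {k : ℕ} (f : Fin k → X → X) (K : Set X) (s : ℝ) (n : ℕ) : ℝ≥0∞ :=
  ⨅ (l : ℕ) (_ : n ≤ l),
    ∑ w : Fin l → Fin k, EMetric.diam (piece f K (List.ofFn w)) ^ s

/-- `H³ˢ(K) = lim_n H³ₙˢ(K)`; the sequence is nondecreasing in `n`, so the limit
is the supremum. -/
noncomputable def H3 {k : ℕ} (f : Fin k → X → X) (K : Set X) (s : ℝ) : ℝ≥0∞ :=
  ⨆ n, H3n f K s n

/-- Fractal dimension III: `dim³(K) = inf {s ≥ 0 : H³ˢ(K) = 0}`. -/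
noncomputable def dim3 {k : ℕ} (f : Fin k → X → X) (K : Set X) : ℝ :=
  sInf {s : ℝ | 0 ≤ s ∧ H3 f K s = 0}

/-- `H⁴ₙˢ(K)`: infimum of `∑ diam (A_i) ^ s` over finite coverings of `K` by
pieces indexed by words of length `≥ n`. -/
noncomputable def H4n {k : ℕ} (f : Fin k → X → X) (K : Set X) (s : ℝ) (n : ℕ) : ℝ≥0∞ :=
  ⨅ (𝒜 : Finset (List (Fin k))) (_ : ∀ w ∈ 𝒜, n ≤ w.length)
      (_ : K ⊆ ⋃ w ∈ 𝒜, piece f K w),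
    ∑ w ∈ 𝒜, EMetric.diam (piece f K w) ^ s

/-- `H⁴ˢ(K) = lim_n H⁴ₙˢ(K)`; the sequence is nondecreasing in `n`, so the limit
is the supremum. -/
noncomputable def H4 {k : ℕ} (f : Fin k → X → X) (K : Set X) (s : ℝ) : ℝ≥0∞ :=
  ⨆ n, H4n f K s n

/-- Fractal dimension IV: `dim⁴(K) = inf {s ≥ 0 : H⁴ˢ(K) = 0}`. -/
noncomputable def dim4 {k : ℕ} (f : Fin k → X → X) (K : Set X) : ℝ :=
  sInf {s : ℝ | 0 ≤ s ∧ H4 f K s = 0}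

/-- Interior of `A` relative to `K` (as a subset of the ambient space `X`). -/
def intK (K A : Set X) : Set X := K \ closure (K \ A)

/-- The level separation property: interiors (in `K`) of two pieces indexed by
distinct words of the same length are disjoint (LSP1), and every piece has
nonempty interior in `K` (LSP2). -/
def LSP {k : ℕ} (f : Fin k → X → X) (K : Set X) : Prop :=
  (∀ v w : List (Fin k), v.length = w.length → v ≠ w →
      intK K (piece f K v) ∩ intK K (piece f K w) = ∅) ∧
  ∀ w : List (Fin k), (intK K (piece f K w)).Nonempty

/-- The natural fractal structure is a tiling: pieces indexed by distinct words
of the same length have disjoint interiors in `K`, and every piece is regularly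
closed in `K`, i.e. `cl_K (int_K (A_i)) = A_i`. -/
def IsTiling {k : ℕ} (f : Fin k → X → X) (K : Set X) : Prop :=
  (∀ v w : List (Fin k), v.length = w.length → v ≠ w →
      intK K (piece f K v) ∩ intK K (piece f K w) = ∅) ∧
  ∀ w : List (Fin k), closure (intK K (piece f K w)) ∩ K = piece f K w


theorem wMap_append {X : Type*} {k : ℕ} (f : Fin k → X → X) (w u : List (Fin k)) (x : X) :
    wMap f (w ++ u) x = wMap f w (wMap f u x) := by
  induction w with
  | nil => rfl
  | cons i w ih => simp [wMap, ih]

theorem dist_wMap_le {k : ℕ} {f : Fin k → X → X} {r : ℝ} (hr : 0 ≤ r)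
    (hf : ∀ i x y, dist (f i x) (f i y) ≤ r * dist x y) (w : List (Fin k)) (x y : X) :
    dist (wMap f w x) (wMap f w y) ≤ r ^ w.length * dist x y := by
  induction w with
  | nil => simp [wMap]
  | cons i w ih =>
    calc dist (f i (wMap f w x)) (f i (wMap f w y))
        ≤ r * dist (wMap f w x) (wMap f w y) := hf _ _ _
      _ ≤ r * (r ^ w.length * dist x y) := mul_le_mul_of_nonneg_left ih hr
      _ = r ^ (i :: w).length * dist x y := by rw [List.length_cons]; ring

theorem exists_mem_piece_of_length {X : Type*} {k : ℕ} {f : Fin k → X → X} {K : Set X}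
    (hK : K ⊆ ⋃ i, f i '' K) (n : ℕ) {x : X} (hx : x ∈ K) :
    ∃ u : List (Fin k), u.length = n ∧ x ∈ piece f K u := by
  induction n generalizing x with
  | zero => exact ⟨[], rfl, x, hx, rfl⟩
  | succ n ih =>
    obtain ⟨i, y, hy, rfl⟩ := Set.mem_iUnion.1 (hK hx)
    obtain ⟨u, rfl, z, hz, rfl⟩ := ih hy
    exact ⟨i :: u, rfl, z, hz, rfl⟩

theorem piece_subset {X : Type*} {k : ℕ} {f : Fin k → X → X} {K : Set X}
    (hK : (⋃ i, f i '' K) ⊆ K) (w : List (Fin k)) : piece f K w ⊆ K := by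
  induction w with
  | nil => simp [piece, wMap]
  | cons i w ih =>
    rintro _ ⟨x, hx, rfl⟩
    exact hK (Set.mem_iUnion.2 ⟨i, wMap f w x, ih ⟨x, hx, rfl⟩, rfl⟩)

/-- Every point of a bounded set `K ⊆ ⋃ i, f i '' K` lies in arbitrarily small pieces, when the
maps `f i` are contractions with a common ratio. -/
theorem exists_piece_subset_ball {k : ℕ} {f : Fin k → X → X} {K : Set X} {r : ℝ} (hr : 0 ≤ r)
    (hr1 : r < 1) (hf : ∀ i x y, dist (f i x) (f i y) ≤ r * dist x y)
    (hb : Bornology.IsBounded K) (hK : K ⊆ ⋃ i, f i '' K) {x : X} (hx : x ∈ K)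
    {ε : ℝ} (hε : 0 < ε) : ∃ u : List (Fin k), piece f K u ⊆ Metric.ball x ε := by
  have hlim : Filter.Tendsto (fun n : ℕ => r ^ n * Metric.diam K) Filter.atTop (nhds 0) := by
    simpa using (tendsto_pow_atTop_nhds_zero_of_lt_one hr hr1).mul_const (Metric.diam K)
  obtain ⟨n, hn⟩ := (hlim.eventually (gt_mem_nhds hε)).exists
  obtain ⟨u, rfl, y, hy, rfl⟩ := exists_mem_piece_of_length hK n hx
  refine ⟨u, ?_⟩
  rintro _ ⟨z, hz, rfl⟩
  calc dist (wMap f u z) (wMap f u y) ≤ r ^ u.length * dist z y := dist_wMap_le hr hf u z y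
    _ ≤ r ^ u.length * Metric.diam K :=
      mul_le_mul_of_nonneg_left (Metric.dist_le_diam_of_mem hb hz hy) (pow_nonneg hr _)
    _ < ε := hn

/-- If a piece is covered by countably many other pieces, then one of its sub-pieces is contained
in one of them. -/
theorem exists_piece_append_subset {k : ℕ} {f : Fin k → X → X} {K : Set X} {r : ℝ} (hr : 0 ≤ r)
    (hr1 : r < 1) (hf : ∀ i x y, dist (f i x) (f i y) ≤ r * dist x y)
    (hKne : K.Nonempty) (hKcp : IsCompact K) (hK : K = ⋃ i, f i '' K)
    {w : List (Fin k)} {S : Set (List (Fin k))} (hcov : piece f K w ⊆ ⋃ v ∈ S, piece f K v) :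
    ∃ v ∈ S, ∃ u, piece f K (w ++ u) ⊆ piece f K v := by
  have hcont (v : List (Fin k)) : Continuous (wMap f v) :=
    (LipschitzWith.of_dist_le_mul (K := ⟨r ^ v.length, pow_nonneg hr _⟩)
      (dist_wMap_le hr hf v)).continuous
  have := isCompact_iff_compactSpace.1 hKcp
  have := hKne.to_subtype
  obtain ⟨v, x, hx⟩ := nonempty_interior_of_iUnion_of_closed
    (f := fun v : S => (fun x : K => wMap f w x) ⁻¹' piece f K v)
    (fun v => (hKcp.image (hcont v)).isClosed.preimage ((hcont w).comp continuous_subtype_val))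
    (Set.eq_univ_of_forall fun x => by
      obtain ⟨v, hv, h⟩ := Set.mem_iUnion₂.1 (hcov ⟨x, x.2, rfl⟩)
      exact Set.mem_iUnion.2 ⟨⟨v, hv⟩, h⟩)
  obtain ⟨ε, hε, hball⟩ := Metric.mem_nhds_iff.1 (mem_interior_iff_mem_nhds.1 hx)
  obtain ⟨u, hu⟩ := exists_piece_subset_ball hr hr1 hf hKcp.isBounded hK.subset x.2 hε
  refine ⟨v, v.2, u, ?_⟩
  rintro _ ⟨z, hz, rfl⟩
  rw [wMap_append]
  have hzu : wMap f u z ∈ piece f K u := ⟨z, hz, rfl⟩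
  exact @hball ⟨wMap f u z, piece_subset hK.superset u hzu⟩ (hu hzu)

theorem stmt_11 {X : Type*} [MetricSpace X] [CompleteSpace X]
    {k : ℕ} (hk : 2 ≤ k) (f : Fin k → X → X) (c : Fin k → ℝ)
    (hc : ∀ i, c i ∈ Set.Ioo (0 : ℝ) 1)
    (hf : ∀ i x y, dist (f i x) (f i y) = c i * dist x y)
    (K : Set X) (hKne : K.Nonempty) (hKcp : IsCompact K)
    (hK : K = ⋃ i, f i '' K)
    (hlsp2 : ∀ w : List (Fin k), (intK K (piece f K w)).Nonempty)
    (hpre : ∀ v w : List (Fin k), piece f K v ⊆ piece f K w → w <+: v) :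
    Irred f K := by
  have : NeZero k := ⟨by omega⟩
  obtain ⟨m, hm⟩ := Finite.exists_max c
  intro w hcov
  obtain ⟨v, ⟨hlen, hne⟩, u, hu⟩ := exists_piece_append_subset (hc m).1.le (hc m).2
    (fun i x y => (hf i x y).trans_le (mul_le_mul_of_nonneg_right (hm i) dist_nonneg))
    hKne hKcp hK hcov
  exact hne ((List.prefix_of_prefix_length_le (hpre _ _ hu) (List.prefix_append w u)
    hlen.le).eq_of_length hlen)

end IFSMoran
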